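/- arXiv:2302.02215 — 3 statements merged into one kernel-verified Lean document; each statement's English description precedes it below -/
import Mathlib

section
/- Let G be a strongly connected digraph and let s be an arbitrary vertex of G. An edge e=(u,v) of G is a strong bridge of G if and only if at least one of the following holds: every path from s to v in G contains the edge e, or every path from u to s in G contains the edge e. -/
/-- A directed multigraph: a type `E` of potential edges with source and target
maps, together with the set of edges actually present in the digraph. -/
structure MultiDigraph (V : Type) (E : Type) where
  edges : Set E
  src : E → V
  tgt : E → V

namespace MultiDigraph

variable {V E : Type}

/-- `G.IsWalk u v l` : the list of edges `l` forms a walk from `u` to `v`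
(consecutive edges compose). -/
def IsWalk (G : MultiDigraph V E) : V → V → List E → Prop
  | u, v, [] => u = v
  | u, v, e :: l => e ∈ G.edges ∧ G.src e = u ∧ G.IsWalk (G.tgt e) v l

/-- A path from `u` to `v`: a walk using no edge more than once. -/
def IsTrail (G : MultiDigraph V E) (u v : V) (l : List E) : Prop :=
  G.IsWalk u v l ∧ l.Nodup

/-- `u` reaches `v`: there is a path from `u` to `v`. -/
def Reaches (G : MultiDigraph V E) (u v : V) : Prop :=
  ∃ l : List E, G.IsTrail u v l

/-- `u` and `v` are strongly connected: each reaches the other. -/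
def SConn (G : MultiDigraph V E) (u v : V) : Prop :=
  G.Reaches u v ∧ G.Reaches v u

/-- The digraph is strongly connected. -/
def StronglyConnected (G : MultiDigraph V E) : Prop :=
  ∀ u v : V, G.Reaches u v

/-- Delete the edge `e`. -/
def deleteEdge (G : MultiDigraph V E) (e : E) : MultiDigraph V E :=
  { G with edges := G.edges \ {e} }

/-- A strong bridge: an edge whose deletion destroys strong connectivity. -/
def IsStrongBridge (G : MultiDigraph V E) (e : E) : Prop :=
  e ∈ G.edges ∧ ¬ (G.deleteEdge e).StronglyConnected

end MultiDigraph

namespace MultiDigraph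

variable {V E : Type} {G : MultiDigraph V E}

theorem isWalk_append {u v : V} {l₁ l₂ : List E} :
    G.IsWalk u v (l₁ ++ l₂) ↔ ∃ w, G.IsWalk u w l₁ ∧ G.IsWalk w v l₂ := by
  induction l₁ generalizing u with
  | nil => simp [IsWalk]
  | cons e l ih => simp [IsWalk, ih, and_assoc]

/-- A walk can be shortcut to a path. -/
theorem IsWalk.reaches {u v : V} {l : List E} (h : G.IsWalk u v l) : G.Reaches u v := by
  induction l generalizing u with
  | nil => exact ⟨[], h, List.nodup_nil⟩
  | cons e l ih =>
    obtain ⟨he, hu, hl⟩ := h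
    obtain ⟨p, hp, hnd⟩ := ih hl
    by_cases hep : e ∈ p
    · obtain ⟨a, b, rfl⟩ := List.append_of_mem hep
      obtain ⟨w, -, -, -, hb⟩ := isWalk_append.mp hp
      exact ⟨e :: b, ⟨he, hu, hb⟩, (List.nodup_append.mp hnd).2.1⟩
    · exact ⟨e :: p, ⟨he, hu, hp⟩, List.nodup_cons.mpr ⟨hep, hnd⟩⟩

theorem Reaches.trans {u v w : V} (h₁ : G.Reaches u v) (h₂ : G.Reaches v w) :
    G.Reaches u w := by
  obtain ⟨l₁, hl₁, -⟩ := h₁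
  obtain ⟨l₂, hl₂, -⟩ := h₂
  exact (isWalk_append.mpr ⟨v, hl₁, hl₂⟩).reaches

theorem isWalk_deleteEdge {e : E} {u v : V} {l : List E} :
    (G.deleteEdge e).IsWalk u v l ↔ G.IsWalk u v l ∧ e ∉ l := by
  induction l generalizing u with
  | nil => simp [IsWalk]
  | cons f l ih =>
    simp only [IsWalk, ih]
    simp only [deleteEdge, Set.mem_sdiff, Set.mem_singleton_iff, List.mem_cons, not_or,
      eq_comm (a := e)]
    tauto

theorem reaches_deleteEdge {e : E} {u v : V} :
    (G.deleteEdge e).Reaches u v ↔ ∃ l, G.IsTrail u v l ∧ e ∉ l := by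
  simp only [Reaches, IsTrail, isWalk_deleteEdge, and_right_comm]

/-- If the endpoints of `e` stay linked after deleting `e`, so does every walk. -/
theorem IsWalk.reaches_deleteEdge {e : E} (he : (G.deleteEdge e).Reaches (G.src e) (G.tgt e))
    {u v : V} {l : List E} (h : G.IsWalk u v l) : (G.deleteEdge e).Reaches u v := by
  induction l generalizing u with
  | nil => exact ⟨[], h, List.nodup_nil⟩
  | cons f l ih =>
    obtain ⟨hf, rfl, hl⟩ := h
    by_cases hfe : f = e
    · subst hfe
      exact he.trans (ih hl)
    · have hstep : (G.deleteEdge e).IsWalk (G.src f) (G.tgt f) [f] := ⟨⟨hf, hfe⟩, rfl, rfl⟩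
      exact hstep.reaches.trans (ih hl)

end MultiDigraph

/-- Let `G` be a strongly connected digraph and `s` any vertex.
An edge `e = (u,v)` is a strong bridge of `G` iff every path from `s` to `v`
contains `e`, or every path from `u` to `s` contains `e` (or both). -/
theorem statement_2 {V E : Type} (G : MultiDigraph V E)
    (hG : G.StronglyConnected) (s : V) (e : E) (he : e ∈ G.edges)
    (u v : V) (hu : G.src e = u) (hv : G.tgt e = v) :
    G.IsStrongBridge e ↔
      ((∀ l : List E, G.IsTrail s v l → e ∈ l) ∨
        (∀ l : List E, G.IsTrail u s l → e ∈ l)) := by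
  subst hu hv
  have hs : ((∀ l : List E, G.IsTrail s (G.tgt e) l → e ∈ l) ∨
      (∀ l : List E, G.IsTrail (G.src e) s l → e ∈ l)) ↔
      ¬ ((G.deleteEdge e).Reaches s (G.tgt e) ∧ (G.deleteEdge e).Reaches (G.src e) s) := by
    simp only [MultiDigraph.reaches_deleteEdge, not_and_or, not_exists, not_not, imp_iff_not_or]
  rw [hs, MultiDigraph.IsStrongBridge, and_iff_right he, not_iff_not]
  refine ⟨fun h => ⟨h _ _, h _ _⟩, fun ⟨h₁, h₂⟩ a b => ?_⟩
  obtain ⟨l, hl, -⟩ := hG a b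
  exact hl.reaches_deleteEdge (h₂.trans h₁)
end

section
/- Let G be a mixed graph and let G' be the digraph obtained from G by splitting every directed edge and replacing every undirected edge with a gadget. Then for any two vertices a and b of G: a and b are 2-edge twinless strongly connected in G' if and only if for every edge e of G (directed or undirected) there exists an orientation R of G \ e in which a and b are strongly connected. -/
namespace MultiDigraph

variable {V E : Type}

/-- The list of edges `l` contains a pair of antiparallel (twin) edges
`(x,y)` and `(y,x)`. -/
def HasTwinPair (G : MultiDigraph V E) (l : List E) : Prop :=
  ∃ x y : V, x ≠ y ∧ (∃ e ∈ l, G.src e = x ∧ G.tgt e = y) ∧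
    (∃ e ∈ l, G.src e = y ∧ G.tgt e = x)

/-- `u` and `v` are twinless strongly connected: there is a path from `u` to `v`
and a path from `v` to `u` whose union contains no pair of antiparallel edges. -/
def TwinlessConn (G : MultiDigraph V E) (u v : V) : Prop :=
  ∃ p q : List E, G.IsTrail u v p ∧ G.IsTrail v u q ∧ ¬ G.HasTwinPair (p ++ q)

/-- `u` and `v` are 2-edge twinless strongly connected: they are twinless
strongly connected in `G \ e` for every edge `e` of `G`. -/
def TwoEdgeTwinlessConn (G : MultiDigraph V E) (u v : V) : Prop :=
  ∀ e ∈ G.edges, (G.deleteEdge e).TwinlessConn u v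

end MultiDigraph

/-- A mixed graph: a set of directed edges (with carrier `E`) and a set of
undirected edges (with carrier `F`, each with two endpoints). -/
structure MixedGraph (V E F : Type) where
  dEdges : Set E
  dsrc : E → V
  dtgt : E → V
  uEdges : Set F
  ufst : F → V
  usnd : F → V

namespace MixedGraph

variable {V E F : Type}

/-- The orientation of `G` determined by a choice `o` of a direction for each
undirected edge: all directed edges are kept, and each undirected edge is
replaced by exactly one of its two possible directions. -/
def orient (G : MixedGraph V E F) (o : F → Bool) : MultiDigraph V (E ⊕ F) where
  edges := Sum.inl '' G.dEdges ∪ Sum.inr '' G.uEdges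
  src := fun p =>
    match p with
    | Sum.inl e => G.dsrc e
    | Sum.inr f => if o f then G.ufst f else G.usnd f
  tgt := fun p =>
    match p with
    | Sum.inl e => G.dtgt e
    | Sum.inr f => if o f then G.usnd f else G.ufst f

/-- Delete a directed edge of the mixed graph. -/
def delD (G : MixedGraph V E F) (e : E) : MixedGraph V E F :=
  { G with dEdges := G.dEdges \ {e} }

/-- Delete an undirected edge of the mixed graph. -/
def delU (G : MixedGraph V E F) (f : F) : MixedGraph V E F :=
  { G with uEdges := G.uEdges \ {f} }

end MixedGraph

namespace MixedGraph

variable {V E F : Type}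

/-- The digraph obtained from the mixed graph `G` by splitting every directed
edge `(x,y)` (inserting a new vertex `Sum.inr (Sum.inl e)`), and replacing
every undirected edge `{x,y}` by a gadget with three new vertices
`z = (f,0)`, `u = (f,1)`, `v = (f,2)` and the seven edges
`(x,z),(z,x),(z,u),(u,v),(v,y),(y,u),(v,z)`. -/
def splitGadget (G : MixedGraph V E F) :
    MultiDigraph (V ⊕ E ⊕ F × Fin 3) (E × Bool ⊕ F × Fin 7) where
  edges := {p | Sum.elim (fun q => q.1 ∈ G.dEdges) (fun q => q.1 ∈ G.uEdges) p}
  src := fun p =>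
    match p with
    | Sum.inl (e, false) => Sum.inl (G.dsrc e)
    | Sum.inl (e, true) => Sum.inr (Sum.inl e)
    | Sum.inr (f, i) =>
        ![Sum.inl (G.ufst f),
          Sum.inr (Sum.inr (f, (0 : Fin 3))),
          Sum.inr (Sum.inr (f, (0 : Fin 3))),
          Sum.inr (Sum.inr (f, (1 : Fin 3))),
          Sum.inr (Sum.inr (f, (2 : Fin 3))),
          Sum.inl (G.usnd f),
          Sum.inr (Sum.inr (f, (2 : Fin 3)))] i
  tgt := fun p =>
    match p with
    | Sum.inl (e, false) => Sum.inr (Sum.inl e)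
    | Sum.inl (e, true) => Sum.inl (G.dtgt e)
    | Sum.inr (f, i) =>
        ![Sum.inr (Sum.inr (f, (0 : Fin 3))),
          Sum.inl (G.ufst f),
          Sum.inr (Sum.inr (f, (1 : Fin 3))),
          Sum.inr (Sum.inr (f, (2 : Fin 3))),
          Sum.inl (G.usnd f),
          Sum.inr (Sum.inr (f, (1 : Fin 3))),
          Sum.inr (Sum.inr (f, (0 : Fin 3)))] i

end MixedGraph

namespace MultiDigraph

variable {V E : Type}

theorem IsWalk.append {G : MultiDigraph V E} {u v w : V} {l m : List E}
    (hl : G.IsWalk u v l) (hm : G.IsWalk v w m) : G.IsWalk u w (l ++ m) := by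
  induction l generalizing u with
  | nil => obtain rfl : u = v := hl; exact hm
  | cons e l ih => exact ⟨hl.1, hl.2.1, ih hl.2.2⟩

theorem IsWalk.suffix {G : MultiDigraph V E} {u v : V} {l m : List E} {e : E}
    (h : G.IsWalk u v (l ++ e :: m)) : G.IsWalk (G.src e) v (e :: m) := by
  induction l generalizing u with
  | nil => exact ⟨h.1, rfl, h.2.2⟩
  | cons e l ih => exact ih h.2.2

theorem IsWalk.exists_isTrail_subset {G : MultiDigraph V E} {u v : V} {l : List E}
    (h : G.IsWalk u v l) : ∃ m, m ⊆ l ∧ G.IsTrail u v m := by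
  induction l generalizing u with
  | nil => exact ⟨[], List.Subset.refl _, h, List.nodup_nil⟩
  | cons e l ih =>
    obtain ⟨he, rfl, hw⟩ := h
    obtain ⟨m, hml, hm, hnd⟩ := ih hw
    by_cases hem : e ∈ m
    · obtain ⟨s, t, rfl⟩ := List.append_of_mem hem
      refine ⟨e :: t, fun x hx => ?_, hm.suffix, (List.nodup_append.1 hnd).2.1⟩
      exact List.mem_cons_of_mem _ (hml (List.mem_append_right _ hx))
    · exact ⟨e :: m, List.cons_subset_cons _ hml, ⟨he, rfl, hm⟩, List.nodup_cons.2 ⟨hem, hnd⟩⟩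

theorem IsWalk.mem_edges {G : MultiDigraph V E} {u v : V} {l : List E}
    (h : G.IsWalk u v l) : ∀ e ∈ l, e ∈ G.edges := by
  induction l generalizing u with
  | nil => simp
  | cons e l ih =>
    intro x hx
    rcases List.mem_cons.1 hx with rfl | hx
    · exact h.1
    · exact ih h.2.2 x hx

/-- A vertex property preserved along every edge of a walk propagates from start to end. -/
theorem IsWalk.propagate {G : MultiDigraph V E} {P : V → Prop} {u v : V} {l : List E}
    (h : G.IsWalk u v l) (hP : ∀ e ∈ l, P (G.src e) → P (G.tgt e)) (hu : P u) : P v := by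
  induction l generalizing u with
  | nil => obtain rfl : u = v := h; exact hu
  | cons e l ih =>
    obtain ⟨-, rfl, hw⟩ := h
    exact ih hw (fun x hx => hP x (List.mem_cons_of_mem _ hx)) (hP e List.mem_cons_self hu)

theorem Reaches.refl (G : MultiDigraph V E) (u : V) : G.Reaches u u :=
  ⟨[], rfl, List.nodup_nil⟩

theorem Reaches.tail {G : MultiDigraph V E} {u : V} {e : E}
    (h : G.Reaches u (G.src e)) (he : e ∈ G.edges) : G.Reaches u (G.tgt e) := by
  obtain ⟨l, hl, -⟩ := h
  have hw : G.IsWalk u (G.tgt e) (l ++ [e]) := hl.append ⟨he, rfl, rfl⟩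
  obtain ⟨m, -, hm⟩ := hw.exists_isTrail_subset
  exact ⟨m, hm⟩

end MultiDigraph

namespace MixedGraph

variable {V E F : Type}

open Classical in
/-- The property of vertices of the split graph induced by a property `R` of vertices of `G`,
when only the edges of the subgraph `H` can be crossed. -/
def Shadow (H : MixedGraph V E F) (R : V → Prop) : V ⊕ E ⊕ F × Fin 3 → Prop
  | Sum.inl v => R v
  | Sum.inr (Sum.inl e) => R (H.dtgt e)
  | Sum.inr (Sum.inr (f, i)) =>
      if f ∈ H.uEdges then R (H.usnd f) else (i = 0 → R (H.ufst f)) ∧ i ≠ 2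

/-- An edge of the split graph is compatible with a subgraph `H` and an orientation `o`. -/
structure Compatible (H : MixedGraph V E F) (o : F → Bool) (p : E × Bool ⊕ F × Fin 7) :
    Prop where
  directed : ∀ e, p = Sum.inl (e, false) → e ∈ H.dEdges
  central : ∀ f, p = Sum.inr (f, 3) → f ∈ H.uEdges
  enter_fst : ∀ f, p = Sum.inr (f, 0) → o f = true
  exit_fst : ∀ f, p = Sum.inr (f, 1) → o f = false

theorem Shadow.step {H : MixedGraph V E F} {o : F → Bool} {a : V}
    {p : E × Bool ⊕ F × Fin 7} (hp : H.Compatible o p)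
    (h : H.Shadow ((H.orient o).Reaches a) (H.splitGadget.src p)) :
    H.Shadow ((H.orient o).Reaches a) (H.splitGadget.tgt p) := by
  have hF : ∀ f ∈ H.uEdges, (H.orient o).Reaches a ((H.orient o).src (Sum.inr f)) →
      (H.orient o).Reaches a ((H.orient o).tgt (Sum.inr f)) :=
    fun f hf hr => hr.tail (Or.inr ⟨f, hf, rfl⟩)
  rcases p with ⟨e, _ | _⟩ | ⟨f, i⟩
  · exact MultiDigraph.Reaches.tail (e := Sum.inl e) h (Or.inl ⟨e, hp.directed e rfl, rfl⟩)
  · exact h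
  · have hf := hF f
    have h0 := hp.enter_fst f
    have h1 := hp.exit_fst f
    have h3 := hp.central f
    by_cases hfU : f ∈ H.uEdges <;> fin_cases i <;>
      simp_all [Shadow, splitGadget, orient]

theorem reaches_of_isWalk_splitGadget {H : MixedGraph V E F} {o : F → Bool} {a b : V}
    {K : MultiDigraph (V ⊕ E ⊕ F × Fin 3) (E × Bool ⊕ F × Fin 7)}
    (hsrc : K.src = H.splitGadget.src) (htgt : K.tgt = H.splitGadget.tgt)
    {l : List (E × Bool ⊕ F × Fin 7)} (hl : K.IsWalk (Sum.inl a) (Sum.inl b) l)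
    (hc : ∀ p ∈ l, H.Compatible o p) : (H.orient o).Reaches a b :=
  hl.propagate (P := H.Shadow ((H.orient o).Reaches a))
    (fun p hp h => by rw [htgt]; rw [hsrc] at h; exact Shadow.step (hc p hp) h)
    (MultiDigraph.Reaches.refl _ a)

/-- Twinless connection in a part of the split graph that only crosses edges of `H` gives an
orientation of `H` with strong connection. -/
theorem exists_orient_sConn {H : MixedGraph V E F} {a b : V}
    {K : MultiDigraph (V ⊕ E ⊕ F × Fin 3) (E × Bool ⊕ F × Fin 7)}
    (hsrc : K.src = H.splitGadget.src) (htgt : K.tgt = H.splitGadget.tgt)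
    (hD : ∀ e, Sum.inl (e, false) ∈ K.edges → e ∈ H.dEdges)
    (hU : ∀ f, Sum.inr (f, 3) ∈ K.edges → f ∈ H.uEdges)
    (h : K.TwinlessConn (Sum.inl a) (Sum.inl b)) :
    ∃ o : F → Bool, (H.orient o).SConn a b := by
  classical
  obtain ⟨p, q, ⟨hp, -⟩, ⟨hq, -⟩, htw⟩ := h
  have hmem : ∀ x ∈ p ++ q, x ∈ K.edges := fun x hx =>
    (List.mem_append.1 hx).elim (hp.mem_edges x) (hq.mem_edges x)
  have hc : ∀ x ∈ p ++ q,
      H.Compatible (fun f => decide (Sum.inr (f, 0) ∈ p ++ q)) x := by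
    intro x hx
    refine ⟨?_, ?_, ?_, ?_⟩
    · rintro e rfl; exact hD e (hmem _ hx)
    · rintro f rfl; exact hU f (hmem _ hx)
    · rintro f rfl; exact decide_eq_true hx
    · rintro f rfl
      refine decide_eq_false fun h0 => htw ?_
      refine ⟨Sum.inl (H.ufst f), Sum.inr (Sum.inr (f, 0)), Sum.inl_ne_inr,
        ⟨_, h0, ?_, ?_⟩, ⟨_, hx, ?_, ?_⟩⟩ <;>
      simp [hsrc, htgt, splitGadget]
  exact ⟨_, reaches_of_isWalk_splitGadget hsrc htgt hp
      fun x hx => hc x (List.mem_append_left _ hx),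
    reaches_of_isWalk_splitGadget hsrc htgt hq
      fun x hx => hc x (List.mem_append_right _ hx)⟩

/-- The edges of the split graph used to simulate the orientation `o` of `H`. -/
def Lifted (H : MixedGraph V E F) (o : F → Bool) : E × Bool ⊕ F × Fin 7 → Prop
  | Sum.inl (e, _) => e ∈ H.dEdges ∧ H.dsrc e ≠ H.dtgt e
  | Sum.inr (f, i) => f ∈ H.uEdges ∧ (i = 0 → o f = true) ∧ (i = 1 → o f = false)

theorem not_hasTwinPair_of_lifted {H : MixedGraph V E F} {o : F → Bool}
    {l : List (E × Bool ⊕ F × Fin 7)} (hl : ∀ p ∈ l, H.Lifted o p) :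
    ¬ H.splitGadget.HasTwinPair l := by
  rintro ⟨x, y, -, ⟨p, hp, rfl, rfl⟩, ⟨q, hq, h1, h2⟩⟩
  replace hp := hl p hp
  replace hq := hl q hq
  clear hl l
  rcases p with ⟨e, _ | _⟩ | ⟨f, i⟩ <;> rcases q with ⟨e', _ | _⟩ | ⟨f', j⟩
  · simp [splitGadget] at h1
  · simp only [splitGadget, Sum.inl.injEq, Sum.inr.injEq] at h1 h2
    subst h1
    exact absurd h2.symm hp.2
  · fin_cases j <;> simp [splitGadget] at h1 h2
  · simp only [splitGadget, Sum.inl.injEq, Sum.inr.injEq] at h1 h2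
    subst h2
    exact absurd h1 hp.2
  · simp [splitGadget] at h1
  · fin_cases j <;> simp [splitGadget] at h1 h2
  · fin_cases i <;> simp [splitGadget] at h1 h2
  · fin_cases i <;> simp [splitGadget] at h1 h2
  · fin_cases i <;> fin_cases j <;> simp [splitGadget] at h1 h2
    · subst h1
      exact absurd (hp.2.1 rfl) (by simp [hq.2.2 rfl])
    · subst h2
      exact absurd (hq.2.1 rfl) (by simp [hp.2.2 rfl])

theorem exists_isWalk_lifted {H : MixedGraph V E F} {o : F → Bool}
    {K : MultiDigraph (V ⊕ E ⊕ F × Fin 3) (E × Bool ⊕ F × Fin 7)}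
    (hsrc : K.src = H.splitGadget.src) (htgt : K.tgt = H.splitGadget.tgt)
    (hK : H.splitGadget.edges ⊆ K.edges) (a : V) {b : V}
    (h : (H.orient o).Reaches a b) :
    ∃ l, K.IsWalk (Sum.inl a) (Sum.inl b) l ∧ ∀ p ∈ l, H.Lifted o p := by
  obtain ⟨l, hl, -⟩ := h
  have hmem := hl.mem_edges
  refine hl.propagate (P := fun v => ∃ l, K.IsWalk (Sum.inl a) (Sum.inl v) l ∧
    ∀ p ∈ l, H.Lifted o p) ?_ ⟨[], rfl, by simp⟩
  rintro (e | f) he ⟨m, hm, hml⟩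
  · have heD : e ∈ H.dEdges := by simpa [orient] using hmem _ he
    have hKe : ∀ c, Sum.inl (e, c) ∈ K.edges := fun c => hK heD
    by_cases hne : H.dsrc e = H.dtgt e
    · exact ⟨m, by simpa [orient, hne] using hm, hml⟩
    · refine ⟨m ++ [Sum.inl (e, false), Sum.inl (e, true)], hm.append ?_, ?_⟩
      · simp [MultiDigraph.IsWalk, hKe, hsrc, htgt, splitGadget, orient]
      · intro p hp
        rcases List.mem_append.1 hp with hp | hp
        · exact hml p hp
        · simp only [List.mem_cons, List.not_mem_nil, or_false] at hp
          rcases hp with rfl | rfl <;> exact ⟨heD, hne⟩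
  · have hfU : f ∈ H.uEdges := by simpa [orient] using hmem _ he
    have hKf : ∀ i, Sum.inr (f, i) ∈ K.edges := fun i => hK hfU
    cases hof : o f
    · refine ⟨m ++ [Sum.inr (f, 5), Sum.inr (f, 3), Sum.inr (f, 6), Sum.inr (f, 1)],
        hm.append ?_, ?_⟩
      · simp [MultiDigraph.IsWalk, hKf, hsrc, htgt, splitGadget, orient, hof]
      · intro p hp
        rcases List.mem_append.1 hp with hp | hp
        · exact hml p hp
        · simp only [List.mem_cons, List.not_mem_nil, or_false] at hp
          rcases hp with rfl | rfl | rfl | rfl <;> simp [Lifted, hfU, hof]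
    · refine ⟨m ++ [Sum.inr (f, 0), Sum.inr (f, 2), Sum.inr (f, 3), Sum.inr (f, 4)],
        hm.append ?_, ?_⟩
      · simp [MultiDigraph.IsWalk, hKf, hsrc, htgt, splitGadget, orient, hof]
      · intro p hp
        rcases List.mem_append.1 hp with hp | hp
        · exact hml p hp
        · simp only [List.mem_cons, List.not_mem_nil, or_false] at hp
          rcases hp with rfl | rfl | rfl | rfl <;> simp [Lifted, hfU, hof]

/-- Strong connection in an orientation of `H` gives twinless connection in any digraph
containing the split graph of `H`. -/
theorem twinlessConn_of_sConn {H : MixedGraph V E F} {o : F → Bool} {a b : V}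
    {K : MultiDigraph (V ⊕ E ⊕ F × Fin 3) (E × Bool ⊕ F × Fin 7)}
    (hsrc : K.src = H.splitGadget.src) (htgt : K.tgt = H.splitGadget.tgt)
    (hK : H.splitGadget.edges ⊆ K.edges) (h : (H.orient o).SConn a b) :
    K.TwinlessConn (Sum.inl a) (Sum.inl b) := by
  obtain ⟨p, hp, hpl⟩ := exists_isWalk_lifted hsrc htgt hK a h.1
  obtain ⟨q, hq, hql⟩ := exists_isWalk_lifted hsrc htgt hK b h.2
  obtain ⟨p', hpp, hp'⟩ := hp.exists_isTrail_subset
  obtain ⟨q', hqq, hq'⟩ := hq.exists_isTrail_subset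
  refine ⟨p', q', hp', hq', ?_⟩
  have hno : ¬ H.splitGadget.HasTwinPair (p' ++ q') :=
    not_hasTwinPair_of_lifted (o := o) fun x hx =>
      (List.mem_append.1 hx).elim (fun hx => hpl x (hpp hx)) (fun hx => hql x (hqq hx))
  simpa only [MultiDigraph.HasTwinPair, hsrc, htgt] using hno

end MixedGraph

/-- Let `G'` be the digraph obtained from the mixed graph `G`
by splitting every directed edge and replacing every undirected edge with a
gadget. Two vertices `a`, `b` of `G` are 2-edge twinless strongly connected in
`G'` iff for every (directed or undirected) edge `e` of `G` there is an
orientation of `G \ e` in which `a` and `b` are strongly connected. -/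
theorem statement_9 {V E F : Type} (G : MixedGraph V E F) (a b : V) :
    G.splitGadget.TwoEdgeTwinlessConn (Sum.inl a) (Sum.inl b) ↔
      ((∀ e ∈ G.dEdges, ∃ o : F → Bool, ((G.delD e).orient o).SConn a b) ∧
        (∀ f ∈ G.uEdges, ∃ o : F → Bool, ((G.delU f).orient o).SConn a b)) := by
  constructor
  · refine fun h => ⟨fun e he => ?_, fun f hf => ?_⟩
    · refine MixedGraph.exists_orient_sConn (H := G.delD e)
        (K := G.splitGadget.deleteEdge (Sum.inl (e, false))) rfl rfl ?_ ?_
        (h (Sum.inl (e, false)) he)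
      · exact fun e' h' => ⟨h'.1, fun heq => h'.2 (by rw [Set.mem_singleton_iff.1 heq]; rfl)⟩
      · exact fun f h' => h'.1
    · refine MixedGraph.exists_orient_sConn (H := G.delU f)
        (K := G.splitGadget.deleteEdge (Sum.inr (f, 3))) rfl rfl ?_ ?_
        (h (Sum.inr (f, 3)) hf)
      · exact fun e h' => h'.1
      · exact fun f' h' => ⟨h'.1, fun heq => h'.2 (by rw [Set.mem_singleton_iff.1 heq]; rfl)⟩
  · rintro ⟨hD, hU⟩ (⟨e, c⟩ | ⟨f, i⟩) hmem
    · obtain ⟨o, ho⟩ := hD e hmem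
      refine MixedGraph.twinlessConn_of_sConn (H := G.delD e) rfl rfl ?_ ho
      rintro (⟨e', c'⟩ | ⟨f', i'⟩) hp
      · exact ⟨hp.1, fun heq => hp.2 (by cases heq; rfl)⟩
      · exact ⟨hp, fun heq => by cases heq⟩
    · obtain ⟨o, ho⟩ := hU f hmem
      refine MixedGraph.twinlessConn_of_sConn (H := G.delU f) rfl rfl ?_ ho
      rintro (⟨e', c'⟩ | ⟨f', i'⟩) hp
      · exact ⟨hp, fun heq => by cases heq⟩
      · exact ⟨hp.1, fun heq => hp.2 (by cases heq; rfl)⟩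
end

section
/- Let G be a connected undirected graph and let X_1,…,X_k be pairwise disjoint subsets of its vertex set such that G \ X_i is connected for every i ∈ {1,…,k}. Let u and v be two vertices of G not belonging to any of X_1,…,X_k, and suppose that for every i ∈ {1,…,k}, u and v belong to the same 2-edge-connected component of G \ X_i. Let G' be the graph obtained from G by contracting each X_i into a single marked vertex (keeping all edges, possibly parallel, between the resulting vertices and discarding loops). Then u and v belong to the same marked vertex-edge block of G'. -/
/-- An undirected multigraph: a type `E` of potential edges, each with two
endpoints, together with the set of edges actually present. -/
structure MultiGraph (V E : Type) where
  edges : Set E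
  fst : E → V
  snd : E → V

namespace MultiGraph

variable {V E : Type}

/-- Adjacency in the multigraph. -/
def Adj (G : MultiGraph V E) (a b : V) : Prop :=
  ∃ e ∈ G.edges, (G.fst e = a ∧ G.snd e = b) ∨ (G.fst e = b ∧ G.snd e = a)

/-- `a` and `b` are connected in `G`. -/
def Reach (G : MultiGraph V E) : V → V → Prop :=
  Relation.ReflTransGen G.Adj

/-- Delete a set of vertices (and all incident edges). -/
def deleteVerts (G : MultiGraph V E) (X : Set V) : MultiGraph V E :=
  { G with edges := {e | e ∈ G.edges ∧ G.fst e ∉ X ∧ G.snd e ∉ X} }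

/-- Delete a single edge. -/
def deleteEdge (G : MultiGraph V E) (e : E) : MultiGraph V E :=
  { G with edges := G.edges \ {e} }

/-- `a` and `b` belong to the same 2-edge-connected component of `G` :
they remain connected after the deletion of any single edge. -/
def Same2ECC (G : MultiGraph V E) (a b : V) : Prop :=
  ∀ e ∈ G.edges, (G.deleteEdge e).Reach a b

/-- The 2-edge-connected component of `G` containing `c`
(a node of the tree of 2-edge-connected components). -/
def eccOf (G : MultiGraph V E) (c : V) : Set V := {w | G.Same2ECC c w}

/-- A bridge of the undirected multigraph `G`. -/
def IsBridge (G : MultiGraph V E) (e : E) : Prop :=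
  e ∈ G.edges ∧ ¬ (G.deleteEdge e).Reach (G.fst e) (G.snd e)

/-- The image of a vertex under the contraction of each set `X i` to the new
(marked) vertex `Sum.inr i`. -/
noncomputable def contractMap (k : ℕ) (X : Fin k → Set V) (w : V) :
    V ⊕ Fin k := by
  classical
  exact if h : ∃ i, w ∈ X i then Sum.inr h.choose else Sum.inl w

/-- The graph obtained from `G` by contracting each set `X i` into the single
(marked) vertex `Sum.inr i`, keeping all (possibly parallel) edges between the
resulting vertices and discarding loops. -/
noncomputable def contract (G : MultiGraph V E) (k : ℕ) (X : Fin k → Set V) :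
    MultiGraph (V ⊕ Fin k) E where
  edges := {e | e ∈ G.edges ∧
    contractMap k X (G.fst e) ≠ contractMap k X (G.snd e)}
  fst := fun e => contractMap k X (G.fst e)
  snd := fun e => contractMap k X (G.snd e)

/-- `a` and `b` belong to the same marked vertex-edge block of `G` (with
marked vertex set `M`): for every marked vertex `z` and every edge `e`, they
remain connected after deleting both `z` and `e`. -/
def SameMVEB (G : MultiGraph V E) (M : Set V) (a b : V) : Prop :=
  ∀ z ∈ M, ∀ e ∈ G.edges, ((G.deleteVerts {z}).deleteEdge e).Reach a b

end MultiGraph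

namespace MultiGraph

theorem contractMap_eq_inr {V : Type} {k : ℕ} {X : Fin k → Set V} {w : V} {i : Fin k}
    (h : contractMap k X w = Sum.inr i) : w ∈ X i := by
  unfold contractMap at h
  split_ifs at h with hw
  exact Sum.inr_injective h ▸ hw.choose_spec

theorem contractMap_of_forall_notMem {V : Type} {k : ℕ} {X : Fin k → Set V} {w : V}
    (h : ∀ i, w ∉ X i) : contractMap k X w = Sum.inl w := by
  unfold contractMap
  rw [dif_neg (by simpa using h)]

/-- Contraction preserves connectivity, provided that every edge not turned into a loop survives. -/
theorem Reach.map_contract {V E : Type} {H : MultiGraph V E} {k : ℕ} {X : Fin k → Set V}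
    {K : MultiGraph (V ⊕ Fin k) E}
    (hfst : ∀ e, K.fst e = contractMap k X (H.fst e))
    (hsnd : ∀ e, K.snd e = contractMap k X (H.snd e))
    (hedges : ∀ e ∈ H.edges, contractMap k X (H.fst e) ≠ contractMap k X (H.snd e) →
      e ∈ K.edges)
    {a b : V} (h : H.Reach a b) : K.Reach (contractMap k X a) (contractMap k X b) := by
  induction h with
  | refl => exact Relation.ReflTransGen.refl
  | @tail c d _ hcd ih =>
    by_cases heq : contractMap k X c = contractMap k X d
    · exact heq ▸ ih
    · refine ih.tail ?_
      obtain ⟨e, he, ⟨rfl, rfl⟩ | ⟨rfl, rfl⟩⟩ := hcd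
      · exact ⟨e, hedges e he heq, Or.inl ⟨hfst e, hsnd e⟩⟩
      · exact ⟨e, hedges e he (Ne.symm heq), Or.inr ⟨hfst e, hsnd e⟩⟩

end MultiGraph

/-- Let `G` be connected, `X 0, …, X (k-1)` pairwise disjoint
vertex sets with each `G \ X i` connected, and `u`, `v` vertices outside all
`X i` lying in the same 2-edge-connected component of every `G \ X i`. Then in
the graph `G'` obtained by contracting each `X i` to a single marked vertex,
`u` and `v` belong to the same marked vertex-edge block. -/
theorem statement_16 {V E : Type} (G : MultiGraph V E) (k : ℕ)
    (X : Fin k → Set V)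
    (hdisj : ∀ i j : Fin k, i ≠ j → Disjoint (X i) (X j))
    (hconn : ∀ a b : V, G.Reach a b)
    (hXconn : ∀ i : Fin k, ∀ a b : V, a ∉ X i → b ∉ X i →
      (G.deleteVerts (X i)).Reach a b)
    (u v : V) (hu : ∀ i, u ∉ X i) (hv : ∀ i, v ∉ X i)
    (h2ecc : ∀ i : Fin k, (G.deleteVerts (X i)).Same2ECC u v) :
    (G.contract k X).SameMVEB (Set.range Sum.inr) (Sum.inl u) (Sum.inl v) := by
  rintro _ ⟨i, rfl⟩ e -
  have hreach : ((G.deleteVerts (X i)).deleteEdge e).Reach u v := by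
    by_cases he : e ∈ (G.deleteVerts (X i)).edges
    · exact h2ecc i e he
    · have heq : (G.deleteVerts (X i)).deleteEdge e = G.deleteVerts (X i) := by
        simp only [MultiGraph.deleteEdge, Set.sdiff_singleton_eq_self he]
      rw [heq]
      exact hXconn i u v (hu i) (hv i)
  rw [← MultiGraph.contractMap_of_forall_notMem hu, ← MultiGraph.contractMap_of_forall_notMem hv]
  refine hreach.map_contract (fun _ => rfl) (fun _ => rfl) ?_
  rintro f ⟨⟨hf, hfst, hsnd⟩, hfe⟩ hne
  exact ⟨⟨⟨hf, hne⟩, fun h => hfst (MultiGraph.contractMap_eq_inr h),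
    fun h => hsnd (MultiGraph.contractMap_eq_inr h)⟩, hfe⟩
end
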